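/- (Theorem 1, achievability of the Improved Routing scheme) Let (U_1,…,U_L) be random variables taking values in finite alphabets 𝒰_1,…,𝒰_L, jointly distributed with the sources according to a pmf of the form p(s_1,…,s_L)·∏_{l=1}^L p(u_l | s_l, u_1,…,u_{l-1}), and let g: 𝒰_1×…×𝒰_L → 𝒵̂ be a function such that E[d(φ(S_1,…,S_L), g(U_1,…,U_L))] ≤ D. If the rate tuple (R_1,…,R_L) satisfies R_l ≥ Σ_{i=1}^{l} I(S_i; U_i | U_1,…,U_{i-1}) for every l = 1,…,L, then (R_1,…,R_L) achieves distortion D. -/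

import Mathlib

namespace Cascade

structure FinPMF (Ω : Type) [Fintype Ω] where
  p : Ω → ℝ
  nonneg : ∀ ω, 0 ≤ p ω
  sum_one : ∑ ω, p ω = 1

variable {Ω : Type} [Fintype Ω]

/-- Probability that the random variable `X` takes the value `x`. -/
noncomputable def prob (μ : FinPMF Ω) {α : Type} [DecidableEq α] (X : Ω → α) (x : α) : ℝ :=
  ∑ ω ∈ Finset.univ.filter (fun ω => X ω = x), μ.p ω

/-- Expectation of a real random variable. -/
noncomputable def expect (μ : FinPMF Ω) (f : Ω → ℝ) : ℝ := ∑ ω, μ.p ω * f ω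

/-- Shannon entropy (base 2) of a finite-valued random variable. -/
noncomputable def entropy (μ : FinPMF Ω) {α : Type} [Fintype α] [DecidableEq α] (X : Ω → α) : ℝ :=
  -∑ x, prob μ X x * Real.logb 2 (prob μ X x)

/-- Conditional mutual information `I(X;Y|Z)` (base 2). -/
noncomputable def condMI (μ : FinPMF Ω) {α β γ : Type} [Fintype α] [DecidableEq α]
    [Fintype β] [DecidableEq β] [Fintype γ] [DecidableEq γ]
    (X : Ω → α) (Y : Ω → β) (Z : Ω → γ) : ℝ :=
  entropy μ (fun ω => (X ω, Z ω)) + entropy μ (fun ω => (Y ω, Z ω))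
    - entropy μ (fun ω => (X ω, Y ω, Z ω)) - entropy μ Z

/-- A cascade code: terminal `l` encodes its observed block together with the message
received from terminal `l-1` (messages are natural numbers; the message of terminal `l`
lies in `Fin (M l)`, and the initial message `m_0` is the constant `0`). -/
structure Code (L n : ℕ) (S : Fin L → Type) (Zhat : Type) where
  M : Fin L → ℕ
  M_pos : ∀ l, 0 < M l
  enc : (l : Fin L) → (Fin n → S l) → ℕ → Fin (M l)
  dec : ℕ → Fin n → Zhat

/-- `msg c s k` is the message `m_k` produced by terminal `k` (with `m_0 = 0`). -/
def msg {L n : ℕ} {S : Fin L → Type} {Zhat : Type} (c : Code L n S Zhat)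
    (s : ∀ l, Fin n → S l) : ℕ → ℕ
  | 0 => 0
  | k + 1 => if h : k < L then (c.enc ⟨k, h⟩ (s ⟨k, h⟩) (msg c s k) : ℕ) else msg c s k

/-- The i.i.d. pmf of `n` copies of the source tuple. -/
noncomputable def iidPMF {L : ℕ} {S : Fin L → Type} [∀ l, Fintype (S l)] (n : ℕ)
    (pS : (∀ l, S l) → ℝ) (h0 : ∀ s, 0 ≤ pS s) (h1 : ∑ s, pS s = 1) :
    FinPMF (Fin n → ∀ l, S l) where
  p ω := ∏ i, pS (ω i)
  nonneg ω := Finset.prod_nonneg fun i _ => h0 (ω i)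
  sum_one := by
    classical
    rw [← Fintype.piFinset_univ, ← Finset.prod_univ_sum (fun _ => Finset.univ) (fun _ s => pS s)]
    simp [h1]

/-- The reconstruction `Ẑ^n` produced by the code on source realization `ω`. -/
def reconstruct {L n : ℕ} {S : Fin L → Type} {Zhat : Type} (c : Code L n S Zhat)
    (ω : Fin n → ∀ l, S l) : Fin n → Zhat :=
  c.dec (msg c (fun l i => ω i l) L)

/-- Average per-letter distortion of the code on source realization `ω`. -/
noncomputable def avgDistortion {L n : ℕ} {S : Fin L → Type} {Zt Zhat : Type}
    (φ : (∀ l, S l) → Zt) (d : Zt → Zhat → ℝ) (c : Code L n S Zhat)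
    (ω : Fin n → ∀ l, S l) : ℝ :=
  (n : ℝ)⁻¹ * ∑ i, d (φ (ω i)) (reconstruct c ω i)

/-- The rate tuple `R` achieves distortion `D` for the cascade source coding problem. -/
def AchievesDistortion {L : ℕ} {S : Fin L → Type} [∀ l, Fintype (S l)]
    (pS : (∀ l, S l) → ℝ) (h0 : ∀ s, 0 ≤ pS s) (h1 : ∑ s, pS s = 1)
    {Zt Zhat : Type} (φ : (∀ l, S l) → Zt) (d : Zt → Zhat → ℝ)
    (R : Fin L → ℝ) (D : ℝ) : Prop :=
  ∀ ε : ℝ, 0 < ε → ∃ n : ℕ, 0 < n ∧ ∃ c : Code L n S Zhat,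
    (∀ l, Real.logb 2 (c.M l) / n ≤ R l + ε) ∧
    expect (iidPMF n pS h0 h1) (avgDistortion φ d c) ≤ D + ε

end Cascade
namespace Cascade

/-- Cost domination by a one-shot code: explicit greedy rejection sampler. -/
lemma stage_rec {A B : Type} [Fintype A] [Fintype B] [Nonempty B]
    (Q : B → ℝ) (hQ0 : ∀ b, 0 ≤ Q b) (hQ1 : ∑ b, Q b = 1)
    (α : A → B → ℝ) (hα0 : ∀ a b, 0 ≤ α a b) (hα1 : ∀ a b, α a b ≤ 1) (N : ℕ) :
    ∃ κ : A → B → ℝ, (∀ a b, 0 ≤ κ a b) ∧ (∀ a, ∑ b, κ a b = 1) ∧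
      (∀ a b, (∑ i ∈ Finset.range N, (1 - ∑ b', Q b' * α a b') ^ i) * (Q b * α a b) ≤ κ a b) ∧
      ∀ c : A → B → ℝ, ∃ (e : A → Fin (N + 1)) (f : Fin (N + 1) → B),
        ∑ a, c a (f (e a)) ≤ ∑ a, ∑ b, κ a b * c a b := by
  classical
  induction N with
  | zero =>
    obtain ⟨b0⟩ := (inferInstance : Nonempty B)
    refine ⟨fun _ b => if b = b0 then 1 else 0, ?_, ?_, ?_, ?_⟩
    · intro a b; dsimp only; split_ifs <;> norm_num
    · intro a; simp
    · intro a b; simp; split_ifs <;> norm_num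
    · intro c
      exact ⟨fun _ => 0, fun _ => b0, by simp⟩
  | succ N ih =>
    obtain ⟨κ, h0, h1, h2, h3⟩ := ih
    have hbar0 : ∀ a, 0 ≤ 1 - ∑ b', Q b' * α a b' := by
      intro a
      have : ∑ b', Q b' * α a b' ≤ ∑ b', Q b' :=
        Finset.sum_le_sum fun b _ => mul_le_of_le_one_right (hQ0 b) (hα1 a b)
      linarith
    refine ⟨fun a b => Q b * α a b + (1 - ∑ b', Q b' * α a b') * κ a b, ?_, ?_, ?_, ?_⟩
    · intro a b
      have := mul_nonneg (hQ0 b) (hα0 a b)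
      have := mul_nonneg (hbar0 a) (h0 a b)
      linarith
    · intro a
      rw [Finset.sum_add_distrib, ← Finset.mul_sum, h1]; ring
    · intro a b
      rw [Finset.sum_range_succ']
      have := mul_le_mul_of_nonneg_left (h2 a b) (hbar0 a)
      have e : (∑ k ∈ Finset.range N, (1 - ∑ b', Q b' * α a b') ^ (k + 1)) =
        (1 - ∑ b', Q b' * α a b') * ∑ k ∈ Finset.range N, (1 - ∑ b', Q b' * α a b') ^ k := by
        rw [Finset.mul_sum]; exact Finset.sum_congr rfl fun i _ => by ring
      rw [e]
      nlinarith
    · intro c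
      have key : ∑ b0, Q b0 * (∑ a, (α a b0 * c a b0 + (1 - α a b0) * ∑ b, κ a b * c a b))
          = ∑ a, ∑ b, (Q b * α a b + (1 - ∑ b', Q b' * α a b') * κ a b) * c a b := by
        simp_rw [Finset.mul_sum]
        rw [Finset.sum_comm]
        refine Finset.sum_congr rfl fun a _ => ?_
        have : ∀ b0, Q b0 * (α a b0 * c a b0 + ∑ b, (1 - α a b0) * (κ a b * c a b))
            = Q b0 * α a b0 * c a b0 + (Q b0 - Q b0 * α a b0) * ∑ b, κ a b * c a b := by
          intro b0; rw [← Finset.mul_sum]; ring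
        simp_rw [this, Finset.sum_add_distrib, add_mul, Finset.sum_add_distrib, mul_assoc]
        rw [← Finset.sum_mul, ← Finset.mul_sum, Finset.sum_sub_distrib, hQ1]
      obtain ⟨b0, hb0⟩ : ∃ b0, (∑ a, (α a b0 * c a b0 + (1 - α a b0) * ∑ b, κ a b * c a b)) ≤
          ∑ a, ∑ b, (Q b * α a b + (1 - ∑ b', Q b' * α a b') * κ a b) * c a b := by
        by_contra! hcon
        rw [← key] at hcon
        set X := ∑ b0, Q b0 * (∑ a, (α a b0 * c a b0 + (1 - α a b0) * ∑ b, κ a b * c a b)) with hX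
        obtain ⟨b1, hb1⟩ : ∃ b, 0 < Q b := by
          by_contra! hc
          have : ∑ b, Q b ≤ 0 := Finset.sum_nonpos fun b _ => hc b
          linarith
        have : ∑ b, Q b * X < X := by
          conv_rhs => rw [hX]
          exact Finset.sum_lt_sum (fun b _ => mul_le_mul_of_nonneg_left (hcon b).le (hQ0 b))
            ⟨b1, Finset.mem_univ _, mul_lt_mul_of_pos_left (hcon b1) hb1⟩
        rw [← Finset.sum_mul, hQ1] at this
        linarith
      obtain ⟨e, f, hef⟩ := h3 (fun a b => (1 - α a b0) * c a b)
      refine ⟨fun a => if c a b0 ≤ c a (f (e a)) then 0 else (e a).succ, Fin.cons b0 f, ?_⟩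
      refine le_trans ?_ hb0
      rw [Finset.sum_add_distrib]
      have e2 : ∑ a, (1 - α a b0) * ∑ b, κ a b * c a b =
          ∑ a, ∑ b, κ a b * ((1 - α a b0) * c a b) := by
        refine Finset.sum_congr rfl fun a _ => ?_
        rw [Finset.mul_sum]; exact Finset.sum_congr rfl fun b _ => by ring
      rw [e2]
      refine le_trans ?_ (add_le_add_right hef _)
      rw [← Finset.sum_add_distrib]
      refine Finset.sum_le_sum fun a _ => ?_
      have := hα0 a b0
      have := hα1 a b0
      dsimp only
      split_ifs with h
      · simp only [Fin.cons_zero]; nlinarith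
      · simp only [Fin.cons_succ]; push Not at h; nlinarith

lemma stage {A B : Type} [Fintype A] [Fintype B] [Nonempty B]
    (Q : B → ℝ) (hQ0 : ∀ b, 0 ≤ Q b) (hQ1 : ∑ b, Q b = 1)
    (P : A → B → ℝ) (hP0 : ∀ a b, 0 ≤ P a b) (hP1 : ∀ a, ∑ b, P a b = 1)
    (T : ℝ) (hT : 1 ≤ T) (N : ℕ) :
    ∃ κ : A → B → ℝ, (∀ a b, 0 ≤ κ a b) ∧ (∀ a, ∑ b, κ a b = 1) ∧
      (∀ a b, P a b ≤ T * Q b → (1 - Real.exp (-(N / T))) * P a b ≤ κ a b) ∧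
      ∀ c : A → B → ℝ, ∃ (e : A → Fin (N + 1)) (f : Fin (N + 1) → B),
        ∑ a, c a (f (e a)) ≤ ∑ a, ∑ b, κ a b * c a b := by
  classical
  have hT0 : 0 < T := by linarith
  set α : A → B → ℝ := fun a b => if P a b ≤ T * Q b then P a b / (T * Q b) else 0 with hα
  have hα0 : ∀ a b, 0 ≤ α a b := by
    intro a b; simp only [hα]; split_ifs
    · exact div_nonneg (hP0 a b) (mul_nonneg hT0.le (hQ0 b))
    · exact le_rfl
  have hα1 : ∀ a b, α a b ≤ 1 := by
    intro a b; simp only [hα]; split_ifs with h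
    · exact div_le_one_of_le₀ h (mul_nonneg hT0.le (hQ0 b))
    · norm_num
  obtain ⟨κ, h0, h1, h2, h3⟩ := stage_rec Q hQ0 hQ1 α hα0 hα1 N
  refine ⟨κ, h0, h1, ?_, h3⟩
  intro a b hab
  refine le_trans ?_ (h2 a b)
  have hQα : ∀ b, P a b ≤ T * Q b → Q b * α a b = P a b / T := by
    intro b hb
    simp only [hα, if_pos hb]
    rcases (hQ0 b).eq_or_lt with h | h
    · have : P a b = 0 := le_antisymm (by rw [← h] at hb; simpa using hb) (hP0 a b)
      rw [this, ← h]; simp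
    · field_simp
  have hbar : ∑ b', Q b' * α a b' ≤ 1 / T := by
    rw [← hP1 a, Finset.sum_div]
    refine Finset.sum_le_sum fun b' _ => ?_
    by_cases hb : P a b' ≤ T * Q b'
    · rw [hQα b' hb]
    · simp only [hα, if_neg hb, mul_zero]; exact div_nonneg (hP0 a b') hT0.le
  rw [hQα b hab]
  have hinv : 1 / T ≤ 1 := by rw [div_le_one hT0]; exact hT
  have hgeo : (1 - Real.exp (-(N / T))) * T ≤ ∑ i ∈ Finset.range N, (1 - ∑ b', Q b' * α a b') ^ i := by
    have s1 : ∑ i ∈ Finset.range N, (1 - 1 / T) ^ i ≤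
        ∑ i ∈ Finset.range N, (1 - ∑ b', Q b' * α a b') ^ i :=
      Finset.sum_le_sum fun i _ => pow_le_pow_left₀ (by linarith) (by linarith) i
    refine le_trans ?_ s1
    have s2 := geom_sum_mul_neg (1 - 1 / T) N
    have s3 : (1 - 1 / T) ^ N ≤ Real.exp (-(N / T)) := by
      have : (1 - 1 / T) ≤ Real.exp (-(1 / T)) := by
        have := Real.add_one_le_exp (-(1 / T)); linarith
      calc (1 - 1 / T) ^ N ≤ (Real.exp (-(1 / T))) ^ N :=
            pow_le_pow_left₀ (by linarith) this N
        _ = _ := by rw [← Real.exp_nat_mul]; congr 1; ring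
    have s4 : (∑ i ∈ Finset.range N, (1 - 1 / T) ^ i) = (1 - (1 - 1 / T) ^ N) * T := by
      rw [← s2]; field_simp; ring
    rw [s4]
    exact mul_le_mul_of_nonneg_right (by linarith) hT0.le
  calc (1 - Real.exp (-(N / T))) * P a b = (1 - Real.exp (-(N / T))) * T * (P a b / T) := by
        field_simp
    _ ≤ _ := mul_le_mul_of_nonneg_right hgeo (div_nonneg (hP0 a b) hT0.le)

/-- The prefix mask. -/
def mask {L : ℕ} {B : Fin L → Type} (l : Fin L) (b : ∀ j, B j) : ∀ j, Option (B j) :=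
  fun j => if j < l then some (b j) else none

lemma mask_update {L : ℕ} {B : Fin L → Type} (l k : Fin L) (h : l ≤ k) (b : ∀ j, B j) (x : B k) :
    mask l (Function.update b k x) = mask l b := by
  funext j
  unfold mask
  split_ifs with hj
  · rw [Function.update_of_ne (ne_of_lt (lt_of_lt_of_le hj h))]
  · rfl

lemma sum_update {ι : Type} [Fintype ι] [DecidableEq ι] {B : ι → Type} [∀ l, Fintype (B l)]
    (k : ι) (F : (∀ j, B j) → ℝ) :
    ∑ b : ∀ j, B j, ∑ x : B k, F (Function.update b k x) = (Fintype.card (B k) : ℝ) * ∑ b, F b := by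
  rw [← Fintype.sum_prod_type' (f := fun (b : ∀ j, B j) (x : B k) => F (Function.update b k x))]
  let T : (∀ j, B j) × B k ≃ (∀ j, B j) × B k :=
    { toFun := fun p => (Function.update p.1 k p.2, p.1 k)
      invFun := fun p => (Function.update p.1 k p.2, p.1 k)
      left_inv := fun p => by simp
      right_inv := fun p => by simp }
  have hT : ∑ p : (∀ j, B j) × B k, F (Function.update p.1 k p.2) = ∑ p : (∀ j, B j) × B k, F p.1 :=
    Fintype.sum_equiv T _ (fun p => F p.1) (fun p => rfl)
  rw [hT, Fintype.sum_prod_type]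
  simp [Finset.mul_sum]

lemma single_step {ι : Type} [Fintype ι] [DecidableEq ι] {B : ι → Type} [∀ l, Fintype (B l)]
    (k : ι) [Nonempty (B k)] (h : (∀ j, B j) → ℝ) (κ : (∀ j, B j) → B k → ℝ)
    (hh : ∀ b x, h (Function.update b k x) = h b)
    (hκ : ∀ b x y, κ (Function.update b k x) y = κ b y)
    (hκ1 : ∀ b, ∑ x, κ b x = 1) :
    ∑ b, h b * κ b (b k) = ∑ b, h b * (Fintype.card (B k) : ℝ)⁻¹ := by
  have hc : (Fintype.card (B k) : ℝ) ≠ 0 := by exact_mod_cast Fintype.card_ne_zero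
  have := sum_update k (fun b => h b * κ b (b k))
  simp only [hh, hκ, Function.update_self] at this
  simp_rw [← Finset.mul_sum, hκ1] at this
  rw [← Finset.sum_mul] at this ⊢
  field_simp
  linarith

/-- Kernels above level `k` are replaced with the uniform one. -/
noncomputable def tailK {L : ℕ} {B : Fin L → Type} [∀ l, Fintype (B l)]
    (K : ∀ l, (∀ j, Option (B j)) → B l → ℝ) (k : ℕ) :
    ∀ l, (∀ j, Option (B j)) → B l → ℝ :=
  fun l v y => if l.val < k then K l v y else (Fintype.card (B l) : ℝ)⁻¹

lemma tail_step {L : ℕ} {B : Fin L → Type} [∀ l, Fintype (B l)] [∀ l, Nonempty (B l)]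
    (K : ∀ l, (∀ j, Option (B j)) → B l → ℝ) (hK : ∀ l v, ∑ y, K l v y = 1)
    (k : Fin L) (g : (∀ j, B j) → ℝ) (hg : ∀ b x, g (Function.update b k x) = g b) :
    ∑ b, g b * ∏ l, tailK K (k.val + 1) l (mask l b) (b l) =
      ∑ b, g b * ∏ l, tailK K k.val l (mask l b) (b l) := by
  have hE : ∀ l ≠ k, ∀ v y, tailK K (k.val + 1) l v y = tailK K k.val l v y := by
    intro l hl v y
    have : l.val ≠ k.val := fun h => hl (Fin.ext h)
    unfold tailK
    by_cases h : l.val < k.val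
    · rw [if_pos h, if_pos (by omega)]
    · rw [if_neg h, if_neg (by omega)]
  have e1 := single_step k (fun b => g b * ∏ l ∈ Finset.univ.erase k, tailK K k.val l (mask l b) (b l))
    (fun b y => K k (mask k b) y) (by
      intro b x
      simp only [hg]
      congr 1
      refine Finset.prod_congr rfl fun l hl => ?_
      have hlk := Finset.ne_of_mem_erase hl
      unfold tailK
      split_ifs with h
      · rw [mask_update l k (by exact Fin.le_def.2 h.le), Function.update_of_ne hlk]
      · rfl) (by
      intro b x y
      simp only [mask_update k k le_rfl]) (fun b => hK k _)
  calc _ = _ := ?_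
    _ = _ := e1
    _ = _ := ?_
  · refine Finset.sum_congr rfl fun b _ => ?_
    rw [← Finset.prod_erase_mul _ _ (Finset.mem_univ k), mul_assoc]
    congr 2
    · exact Finset.prod_congr rfl fun l hl => hE l (Finset.ne_of_mem_erase hl) _ _
    · simp [tailK]
  · refine Finset.sum_congr rfl fun b _ => ?_
    rw [← Finset.prod_erase_mul _ _ (Finset.mem_univ k), mul_assoc]
    congr 2
    simp [tailK]

lemma tail_eq {L : ℕ} {B : Fin L → Type} [∀ l, Fintype (B l)] [∀ l, Nonempty (B l)]
    (K : ∀ l, (∀ j, Option (B j)) → B l → ℝ) (hK : ∀ l v, ∑ y, K l v y = 1)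
    (k : ℕ) (hk : k ≤ L) (g : (∀ j, B j) → ℝ)
    (hg : ∀ (j : Fin L), k ≤ j.val → ∀ b x, g (Function.update b j x) = g b) :
    ∑ b, g b * ∏ l, K l (mask l b) (b l) =
      ∑ b, g b * ∏ l, tailK K k l (mask l b) (b l) := by
  induction hk using Nat.decreasingInduction with
  | self =>
    refine Finset.sum_congr rfl fun b _ => ?_
    congr 1
    refine Finset.prod_congr rfl fun l _ => ?_
    simp [tailK]
  | of_succ k hk ih =>
    rw [ih (fun j hj => hg j (by omega))]
    exact tail_step K hK ⟨k, hk⟩ g (hg ⟨k, hk⟩ le_rfl)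

lemma chain_sum_one {L : ℕ} {B : Fin L → Type} [∀ l, Fintype (B l)] [∀ l, Nonempty (B l)]
    (K : ∀ l, (∀ j, Option (B j)) → B l → ℝ) (hK : ∀ l v, ∑ y, K l v y = 1) :
    ∑ b : ∀ j, B j, ∏ l, K l (mask l b) (b l) = 1 := by
  have := tail_eq K hK 0 (Nat.zero_le _) (fun _ => 1) (fun _ _ _ _ => rfl)
  simp only [one_mul] at this
  rw [this]
  simp only [tailK, Nat.not_lt_zero, if_false]
  rw [Finset.sum_const, Finset.card_univ, Fintype.card_pi, nsmul_eq_mul]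
  push_cast
  rw [← Finset.prod_mul_distrib]
  exact Finset.prod_eq_one fun l _ => mul_inv_cancel₀ (by exact_mod_cast Fintype.card_ne_zero)

/-- Conditional independence given the prefix. -/
lemma chain_cond {L : ℕ} {B : Fin L → Type} [∀ l, Fintype (B l)] [∀ l, Nonempty (B l)]
    [∀ l, DecidableEq (B l)]
    (K : ∀ l, (∀ j, Option (B j)) → B l → ℝ) (hK : ∀ l v, ∑ y, K l v y = 1)
    (k : Fin L) (y : B k) (z : ∀ j, Option (B j)) :
    ∑ b : ∀ j, B j, (if b k = y ∧ mask k b = z then (1 : ℝ) else 0) * ∏ l, K l (mask l b) (b l) =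
      K k z y * ∑ b : ∀ j, B j, (if mask k b = z then (1 : ℝ) else 0) * ∏ l, K l (mask l b) (b l) := by
  rw [tail_eq K hK (k.val + 1) k.isLt _ (by
      intro j hj b x
      rw [mask_update k j (by exact Fin.le_def.2 (by omega)), Function.update_of_ne]
      intro h; rw [h] at hj; omega),
    tail_eq K hK k.val k.isLt.le (fun b => if mask k b = z then (1 : ℝ) else 0) (by
      intro j hj b x
      rw [mask_update k j (by exact Fin.le_def.2 hj)])]
  have e1 := single_step k
    (fun b => K k z y * ((if mask k b = z then (1 : ℝ) else 0) *
      ∏ l ∈ Finset.univ.erase k, tailK K k.val l (mask l b) (b l)))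
    (fun b y' => if y' = y then 1 else 0) (by
      intro b x
      simp only [mask_update k k le_rfl]
      congr 2
      refine Finset.prod_congr rfl fun l hl => ?_
      have hlk := Finset.ne_of_mem_erase hl
      unfold tailK
      split_ifs with h
      · rw [mask_update l k (by exact Fin.le_def.2 h.le), Function.update_of_ne hlk]
      · rfl) (fun _ _ _ => rfl) (by intro b; simp)
  rw [Finset.mul_sum]
  calc _ = _ := ?_
    _ = _ := e1
    _ = _ := ?_
  · refine Finset.sum_congr rfl fun b _ => ?_
    rw [← Finset.prod_erase_mul _ _ (Finset.mem_univ k)]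
    have : ∏ l ∈ Finset.univ.erase k, tailK K (k.val + 1) l (mask l b) (b l) =
        ∏ l ∈ Finset.univ.erase k, tailK K k.val l (mask l b) (b l) := by
      refine Finset.prod_congr rfl fun l hl => ?_
      have : l.val ≠ k.val := fun h => Finset.ne_of_mem_erase hl (Fin.ext h)
      unfold tailK
      by_cases h : l.val < k.val
      · rw [if_pos h, if_pos (by omega)]
      · rw [if_neg h, if_neg (by omega)]
    rw [this]
    by_cases h1 : b k = y
    · by_cases h2 : mask k b = z
      · simp [h1, h2, tailK]; ring
      · simp [h2]
    · simp [h1]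
  · refine Finset.sum_congr rfl fun b _ => ?_
    rw [← Finset.prod_erase_mul _ _ (Finset.mem_univ k)]
    simp only [tailK, lt_irrefl, if_false]
    ring

end Cascade
namespace Cascade

noncomputable def cost {L : ℕ} {A B : Fin L → Type} [∀ l, Fintype (A l)] [∀ l, Fintype (B l)]
    (pA : (∀ l, A l) → ℝ) (δ : (∀ l, A l) → (∀ l, B l) → ℝ)
    (K : ∀ l, (∀ j, Option (B j)) → A l → B l → ℝ) : ℝ :=
  ∑ a, ∑ b, pA a * (∏ l, K l (mask l b) (a l) (b l)) * δ a b

/-- Kernel of a deterministic code with `N` codewords per prefix. -/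
def IsDet {V A B : Type} (N : ℕ) (κ : V → A → B → ℝ) : Prop :=
  ∃ (e : V → A → Fin N) (f : V → Fin N → B), (∀ v a b, f v (e v a) = b → κ v a b = 1) ∧
    ∀ v a b, f v (e v a) ≠ b → κ v a b = 0

lemma sum_fiber {P T : Type} [Fintype P] [Fintype T] [DecidableEq T] (t : P → T) (κ : T → ℝ)
    (w : P → ℝ) :
    ∑ p, κ (t p) * w p = ∑ x, κ x * ∑ p ∈ Finset.univ.filter (fun p => t p = x), w p := by
  rw [← Finset.sum_fiberwise Finset.univ t]
  refine Finset.sum_congr rfl fun x _ => ?_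
  rw [Finset.mul_sum]
  refine Finset.sum_congr rfl fun p hp => ?_
  rw [(Finset.mem_filter.1 hp).2]

lemma replace_one {L : ℕ} {A B : Fin L → Type} [∀ l, Fintype (A l)] [∀ l, Fintype (B l)]
    (pA : (∀ l, A l) → ℝ) (δ : (∀ l, A l) → (∀ l, B l) → ℝ)
    (K : ∀ l, (∀ j, Option (B j)) → A l → B l → ℝ) (k : Fin L) (N : ℕ)
    (hdom : ∀ v, ∀ c : A k → B k → ℝ, ∃ (e : A k → Fin N) (f : Fin N → B k),
        ∑ a, c a (f (e a)) ≤ ∑ a, ∑ b, K k v a b * c a b) :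
    ∃ κ', IsDet N κ' ∧ cost pA δ (Function.update K k κ') ≤ cost pA δ K := by
  classical
  let t : (∀ l, A l) × (∀ l, B l) → (∀ j, Option (B j)) × A k × B k :=
    fun p => (mask k p.2, p.1 k, p.2 k)
  let w : (∀ l, A l) × (∀ l, B l) → ℝ := fun p =>
    pA p.1 * (∏ l ∈ Finset.univ.erase k, K l (mask l p.2) (p.1 l) (p.2 l)) * δ p.1 p.2
  let c : (∀ j, Option (B j)) → A k → B k → ℝ := fun v x y =>
    ∑ p ∈ Finset.univ.filter (fun p => t p = (v, x, y)), w p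
  have hcost : ∀ κ : (∀ j, Option (B j)) → A k → B k → ℝ,
      cost pA δ (Function.update K k κ) = ∑ v, ∑ x, ∑ y, κ v x y * c v x y := by
    intro κ
    have := sum_fiber t (fun z => κ z.1 z.2.1 z.2.2) w
    simp only [Fintype.sum_prod_type] at this
    rw [← this]
    unfold cost
    refine Finset.sum_congr rfl fun a _ => Finset.sum_congr rfl fun b _ => ?_
    rw [← Finset.prod_erase_mul _ _ (Finset.mem_univ k)]
    simp only [Function.update_self, t, w]
    have : ∏ x ∈ Finset.univ.erase k, Function.update K k κ x (mask x b) (a x) (b x) =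
        ∏ l ∈ Finset.univ.erase k, K l (mask l b) (a l) (b l) := by
      refine Finset.prod_congr rfl fun l hl => ?_
      rw [Function.update_of_ne (Finset.ne_of_mem_erase hl)]
    rw [this]; ring
  choose e f hef using fun v => hdom v (c v)
  refine ⟨fun v a b => if f v (e v a) = b then 1 else 0, ⟨e, f, ?_, ?_⟩, ?_⟩
  · intro v a b h; simp [h]
  · intro v a b h; simp [h]
  · rw [hcost]
    have := hcost (K k)
    rw [Function.update_eq_self] at this
    rw [this]
    refine Finset.sum_le_sum fun v _ => ?_
    simpa using hef v

lemma replace_all {L : ℕ} {A B : Fin L → Type} [∀ l, Fintype (A l)] [∀ l, Fintype (B l)]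
    (pA : (∀ l, A l) → ℝ) (δ : (∀ l, A l) → (∀ l, B l) → ℝ)
    (K : ∀ l, (∀ j, Option (B j)) → A l → B l → ℝ) (N : Fin L → ℕ)
    (hdom : ∀ l, ∀ v, ∀ c : A l → B l → ℝ, ∃ (e : A l → Fin (N l)) (f : Fin (N l) → B l),
        ∑ a, c a (f (e a)) ≤ ∑ a, ∑ b, K l v a b * c a b) :
    ∃ K' : ∀ l, (∀ j, Option (B j)) → A l → B l → ℝ,
      (∀ l, IsDet (N l) (K' l)) ∧ cost pA δ K' ≤ cost pA δ K := by
  classical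
  have : ∀ s : Finset (Fin L), ∃ K' : ∀ l, (∀ j, Option (B j)) → A l → B l → ℝ,
      (∀ l ∈ s, IsDet (N l) (K' l)) ∧ (∀ l ∉ s, K' l = K l) ∧ cost pA δ K' ≤ cost pA δ K := by
    intro s
    induction s using Finset.induction_on with
    | empty => exact ⟨K, by simp, by simp, le_rfl⟩
    | insert k s hk ih =>
      obtain ⟨K', h1, h2, h3⟩ := ih
      obtain ⟨κ', hd, hc⟩ := replace_one pA δ K' k (N k) (by rw [h2 k hk]; exact hdom k)
      refine ⟨Function.update K' k κ', ?_, ?_, hc.trans h3⟩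
      · intro l hl
        by_cases hlk : l = k
        · subst hlk; simpa using hd
        · rw [Function.update_of_ne hlk]
          exact h1 l (Finset.mem_of_mem_insert_of_ne hl hlk)
      · intro l hl
        rw [Finset.mem_insert, not_or] at hl
        rw [Function.update_of_ne hl.1, h2 l hl.2]
  obtain ⟨K', h1, _, h3⟩ := this Finset.univ
  exact ⟨K', fun l => h1 l (Finset.mem_univ _), h3⟩

open Classical in
lemma one_shot {L : ℕ} {A B : Fin L → Type} [∀ l, Fintype (A l)] [∀ l, Fintype (B l)]
    [∀ l, Nonempty (B l)]
    (pA : (∀ l, A l) → ℝ) (hpA0 : ∀ a, 0 ≤ pA a) (hpA1 : ∑ a, pA a = 1)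
    (δ : (∀ l, A l) → (∀ l, B l) → ℝ) (hδ0 : ∀ a b, 0 ≤ δ a b)
    (dmax : ℝ) (hδ1 : ∀ a b, δ a b ≤ dmax)
    (K : ∀ l, (∀ j, Option (B j)) → A l → B l → ℝ)
    (hK0 : ∀ l v a b, 0 ≤ K l v a b) (hK1 : ∀ l v a, ∑ b, K l v a b = 1)
    (Q : ∀ l, (∀ j, Option (B j)) → B l → ℝ)
    (hQ0 : ∀ l v b, 0 ≤ Q l v b) (hQ1 : ∀ l v, ∑ b, Q l v b = 1)
    (T : Fin L → ℝ) (hT : ∀ l, 1 ≤ T l) (N : Fin L → ℕ) (η : ℝ) (hη0 : 0 ≤ η) (hη1 : η ≤ 1)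
    (hη : ∀ l, Real.exp (-(N l / T l)) ≤ η) :
    ∃ K' : ∀ l, (∀ j, Option (B j)) → A l → B l → ℝ,
      (∀ l, IsDet (N l + 1) (K' l)) ∧
      cost pA δ K' ≤ cost pA δ K + dmax * (1 - (1 - η) ^ L *
        ∑ a, ∑ b, pA a * (∏ l, K l (mask l b) (a l) (b l)) *
          (if ∀ l, K l (mask l b) (a l) (b l) ≤ T l * Q l (mask l b) (b l) then 1 else 0)) := by
  choose κ hκ0 hκ1 hκ2 hκ3 using fun l v =>
    stage (Q l v) (hQ0 l v) (hQ1 l v) (K l v) (hK0 l v) (hK1 l v) (T l) (hT l) (N l)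
  obtain ⟨K', hdet, hc⟩ := replace_all pA δ κ (fun l => N l + 1) hκ3
  refine ⟨K', hdet, hc.trans ?_⟩
  set I : (∀ l, A l) → (∀ l, B l) → ℝ := fun a b =>
    if ∀ l, K l (mask l b) (a l) (b l) ≤ T l * Q l (mask l b) (b l) then 1 else 0 with hI
  have hI01 : ∀ a b, 0 ≤ I a b ∧ I a b ≤ 1 := by
    intro a b; simp only [hI]; split_ifs <;> norm_num
  have hpow1 : (1 - η) ^ L ≤ 1 := pow_le_one₀ (by linarith) (by linarith)
  have hpow0 : 0 ≤ (1 - η) ^ L := pow_nonneg (by linarith) _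
  have hlow : ∀ a b, (1 - η) ^ L * ((∏ l, K l (mask l b) (a l) (b l)) * I a b) ≤
      ∏ l, κ l (mask l b) (a l) (b l) := by
    intro a b
    simp only [hI]
    split_ifs with h
    · have : (1 - η) ^ L = ∏ _l : Fin L, (1 - η) := by simp
      rw [this, mul_one, ← Finset.prod_mul_distrib]
      refine Finset.prod_le_prod (fun l _ => mul_nonneg (by linarith) (hK0 _ _ _ _)) fun l _ => ?_
      refine le_trans ?_ (hκ2 l (mask l b) (a l) (b l) (h l))
      exact mul_le_mul_of_nonneg_right (by linarith [hη l]) (hK0 _ _ _ _)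
    · rw [mul_zero, mul_zero]
      exact Finset.prod_nonneg fun l _ => hκ0 _ _ _ _
  have hsum : ∑ a, ∑ b : ∀ l, B l, pA a * ∏ l, κ l (mask l b) (a l) (b l) = 1 := by
    rw [← hpA1]
    refine Finset.sum_congr rfl fun a _ => ?_
    rw [← Finset.mul_sum, chain_sum_one (fun l v y => κ l v (a l) y) (fun l v => hκ1 l v (a l)), mul_one]
  have hterm : ∀ a b, pA a * (∏ l, κ l (mask l b) (a l) (b l)) * δ a b ≤
      pA a * (∏ l, K l (mask l b) (a l) (b l)) * δ a b +
      dmax * (pA a * (∏ l, κ l (mask l b) (a l) (b l)) -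
        (1 - η) ^ L * (pA a * (∏ l, K l (mask l b) (a l) (b l)) * I a b)) := by
    intro a b
    have h1 := hlow a b
    set x := ∏ l, κ l (mask l b) (a l) (b l)
    have hy : 0 ≤ ∏ l, K l (mask l b) (a l) (b l) := Finset.prod_nonneg fun l _ => hK0 _ _ _ _
    set y := ∏ l, K l (mask l b) (a l) (b l)
    have h2 : (1 - η) ^ L * (y * I a b) ≤ y := by
      have : y * I a b ≤ y := mul_le_of_le_one_right hy (hI01 a b).2
      have := mul_le_of_le_one_left (mul_nonneg hy (hI01 a b).1) hpow1
      linarith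
    set z := (1 - η) ^ L * (y * I a b) with hz
    have h3 : x * δ a b ≤ y * δ a b + dmax * (x - z) := by
      have e1 : (x - z) * δ a b ≤ (x - z) * dmax :=
        mul_le_mul_of_nonneg_left (hδ1 a b) (by linarith)
      have e2 : z * δ a b ≤ y * δ a b := mul_le_mul_of_nonneg_right h2 (hδ0 a b)
      linarith
    have h4 := mul_le_mul_of_nonneg_left h3 (hpA0 a)
    calc _ = pA a * (x * δ a b) := by ring
      _ ≤ _ := h4
      _ = _ := by rw [hz]; ring
  calc cost pA δ κ ≤ _ := Finset.sum_le_sum fun a _ => Finset.sum_le_sum fun b _ => hterm a b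
    _ = _ := by
      simp_rw [Finset.sum_add_distrib, ← Finset.mul_sum, Finset.sum_sub_distrib, ← Finset.mul_sum]
      simp_rw [← Finset.mul_sum] at hsum
      rw [hsum]
      rfl

/-! ### The cascade code -/

/-- Decoded prefix. -/
def dp {L : ℕ} {B : Fin L → Type} (N : Fin L → ℕ) (hN : ∀ l, 0 < N l)
    (f : ∀ l, (∀ j, Option (B j)) → Fin (N l) → B l) : ℕ → ℕ → (∀ j, Option (B j))
  | 0, _ => fun _ => none
  | k + 1, m => if h : k < L then
      Function.update (dp N hN f k (m / N ⟨k, h⟩)) ⟨k, h⟩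
        (some (f ⟨k, h⟩ (dp N hN f k (m / N ⟨k, h⟩)) ⟨m % N ⟨k, h⟩, Nat.mod_lt _ (hN _)⟩))
    else dp N hN f k m

/-- Prefix produced by the encoders. -/
def vv {L : ℕ} {B A : Fin L → Type}
    (F : ∀ l, (∀ j, Option (B j)) → A l → B l) (a : ∀ l, A l) : ℕ → (∀ j, Option (B j))
  | 0 => fun _ => none
  | k + 1 => if h : k < L then
      Function.update (vv F a k) ⟨k, h⟩ (some (F ⟨k, h⟩ (vv F a k) (a ⟨k, h⟩)))
    else vv F a k

lemma vv_eq {L : ℕ} {B A : Fin L → Type}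
    (F : ∀ l, (∀ j, Option (B j)) → A l → B l) (a : ∀ l, A l) (k : ℕ) (hk : k ≤ L) (j : Fin L) :
    vv F a k j = if j.val < k then some (F j (vv F a j.val) (a j)) else none := by
  induction k with
  | zero => simp [vv]
  | succ k ih =>
    rw [vv, dif_pos (by omega)]
    by_cases hj : j = ⟨k, by omega⟩
    · subst hj; simp
    · rw [Function.update_of_ne hj, ih (by omega)]
      have : j.val ≠ k := fun h => hj (Fin.ext h)
      by_cases h : j.val < k
      · rw [if_pos h, if_pos (by omega)]
      · rw [if_neg h, if_neg (by omega)]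

lemma vv_mask {L : ℕ} {B A : Fin L → Type}
    (F : ∀ l, (∀ j, Option (B j)) → A l → B l) (a : ∀ l, A l) (l : Fin L) :
    vv F a l.val = mask l (fun j => F j (vv F a j.val) (a j)) := by
  funext j
  rw [vv_eq F a l.val l.isLt.le j]
  rfl

/-- Total message counts. -/
def Mtot {L : ℕ} (N : Fin L → ℕ) (k : ℕ) : ℕ :=
  ∏ i ∈ Finset.univ.filter (fun i : Fin L => i.val < k), N i

lemma Mtot_succ {L : ℕ} (N : Fin L → ℕ) (k : ℕ) (h : k < L) :
    Mtot N (k + 1) = Mtot N k * N ⟨k, h⟩ := by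
  unfold Mtot
  have : Finset.univ.filter (fun i : Fin L => i.val < k + 1) =
      insert ⟨k, h⟩ (Finset.univ.filter (fun i : Fin L => i.val < k)) := by
    ext i; simp [Fin.ext_iff]; omega
  rw [this, Finset.prod_insert (by simp), mul_comm]

lemma Mtot_pos {L : ℕ} (N : Fin L → ℕ) (hN : ∀ l, 0 < N l) (k : ℕ) : 0 < Mtot N k :=
  Finset.prod_pos fun i _ => hN i

def mkCode {L n : ℕ} {S : Fin L → Type} {Zhat : Type} {B : Fin L → Type}
    (N : Fin L → ℕ) (hN : ∀ l, 0 < N l)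
    (e : ∀ l, (∀ j, Option (B j)) → (Fin n → S l) → Fin (N l))
    (f : ∀ l, (∀ j, Option (B j)) → Fin (N l) → B l)
    (G : (∀ j, Option (B j)) → Fin n → Zhat) : Code L n S Zhat where
  M l := Mtot N (l.val + 1)
  M_pos _ := Mtot_pos N hN _
  enc l s m := ⟨(m * N l + (e l (dp N hN f l.val m) s).val) % Mtot N (l.val + 1),
    Nat.mod_lt _ (Mtot_pos N hN _)⟩
  dec m := G (dp N hN f L m)

lemma mkCode_msg {L n : ℕ} {S : Fin L → Type} {Zhat : Type} {B : Fin L → Type}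
    (N : Fin L → ℕ) (hN : ∀ l, 0 < N l)
    (e : ∀ l, (∀ j, Option (B j)) → (Fin n → S l) → Fin (N l))
    (f : ∀ l, (∀ j, Option (B j)) → Fin (N l) → B l)
    (G : (∀ j, Option (B j)) → Fin n → Zhat) (s : ∀ l, Fin n → S l) (k : ℕ) (hk : k ≤ L) :
    msg (mkCode N hN e f G) s k < Mtot N k ∧
    dp N hN f k (msg (mkCode N hN e f G) s k) = vv (fun l v x => f l v (e l v x)) s k := by
  induction k with
  | zero => exact ⟨by simp [msg, Mtot], rfl⟩
  | succ k ih =>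
    have h : k < L := by omega
    obtain ⟨h1, h2⟩ := ih h.le
    set m := msg (mkCode N hN e f G) s k with hm
    have hlt := (e ⟨k, h⟩ (dp N hN f k m) (s ⟨k, h⟩)).isLt
    have hmsg : msg (mkCode N hN e f G) s (k + 1) =
        m * N ⟨k, h⟩ + (e ⟨k, h⟩ (dp N hN f k m) (s ⟨k, h⟩)).val := by
      rw [msg, dif_pos h]
      simp only [mkCode]
      apply Nat.mod_eq_of_lt
      rw [Mtot_succ N k h]
      calc _ < m * N ⟨k, h⟩ + N ⟨k, h⟩ := Nat.add_lt_add_left hlt _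
        _ = (m + 1) * N ⟨k, h⟩ := by ring
        _ ≤ _ := Nat.mul_le_mul_right _ h1
    refine ⟨?_, ?_⟩
    · rw [msg, dif_pos h]
      exact Fin.isLt _
    · rw [hmsg, dp, dif_pos h, vv, dif_pos h]
      have hdiv : (m * N ⟨k, h⟩ + (e ⟨k, h⟩ (dp N hN f k m) (s ⟨k, h⟩)).val) / N ⟨k, h⟩ = m := by
        rw [mul_comm, Nat.mul_add_div (hN _), Nat.div_eq_of_lt hlt, add_zero]
      have hmod : (m * N ⟨k, h⟩ + (e ⟨k, h⟩ (dp N hN f k m) (s ⟨k, h⟩)).val) % N ⟨k, h⟩ =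
          (e ⟨k, h⟩ (dp N hN f k m) (s ⟨k, h⟩)).val := by
        rw [mul_comm, Nat.mul_add_mod, Nat.mod_eq_of_lt hlt]
      simp only [h2] at hdiv hmod
      simp only [h2, hdiv, hmod, Fin.eta]

end Cascade
namespace Cascade

lemma iid_succ {Ω : Type} [Fintype Ω] (p : Ω → ℝ) (n : ℕ) (F : (Fin (n + 1) → Ω) → ℝ) :
    ∑ ω : Fin (n + 1) → Ω, (∏ i, p (ω i)) * F ω =
      ∑ x, ∑ ω : Fin n → Ω, p x * ((∏ i, p (ω i)) * F (Fin.cons x ω)) := by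
  rw [← Fintype.sum_prod_type' (f := fun (x : Ω) (ω : Fin n → Ω) =>
    p x * ((∏ i, p (ω i)) * F (Fin.cons x ω)))]
  symm
  refine Fintype.sum_equiv (Fin.consEquiv (fun _ => Ω)) _ _ fun z => ?_
  simp only [Fin.consEquiv, Equiv.coe_fn_mk, Fin.prod_univ_succ, Fin.cons_zero, Fin.cons_succ]
  ring

lemma iid_one {Ω : Type} [Fintype Ω] (p : Ω → ℝ) (hp : ∑ x, p x = 1) (n : ℕ) :
    ∑ ω : Fin n → Ω, ∏ i, p (ω i) = 1 := by
  classical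
  rw [← Fintype.piFinset_univ, ← Finset.prod_univ_sum (fun _ => Finset.univ) (fun _ s => p s)]
  simp [hp]

lemma iid_mean {Ω : Type} [Fintype Ω] (p : Ω → ℝ) (hp : ∑ x, p x = 1) (Y : Ω → ℝ) (n : ℕ) :
    ∑ ω : Fin n → Ω, (∏ i, p (ω i)) * ∑ i, Y (ω i) = n * ∑ x, p x * Y x := by
  induction n with
  | zero => simp
  | succ n ih =>
    rw [iid_succ]
    simp only [Fin.sum_univ_succ, Fin.cons_zero, Fin.cons_succ, mul_add, Finset.sum_add_distrib,
      ← Finset.mul_sum, ih, ← Finset.sum_mul, iid_one p hp n, hp]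
    push_cast; ring

lemma iid_sq {Ω : Type} [Fintype Ω] (p : Ω → ℝ) (hp : ∑ x, p x = 1) (Y : Ω → ℝ)
    (hY : ∑ x, p x * Y x = 0) (n : ℕ) :
    ∑ ω : Fin n → Ω, (∏ i, p (ω i)) * (∑ i, Y (ω i)) ^ 2 = n * ∑ x, p x * Y x ^ 2 := by
  induction n with
  | zero => simp
  | succ n ih =>
    rw [iid_succ]
    have e : ∀ x, ∑ ω : Fin n → Ω, p x * ((∏ i, p (ω i)) *
        (∑ i : Fin (n + 1), Y ((Fin.cons x ω : Fin (n + 1) → Ω) i)) ^ 2) =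
        p x * Y x ^ 2 + p x * (n * ∑ x, p x * Y x ^ 2) := by
      intro x
      simp only [Fin.sum_univ_succ, Fin.cons_zero, Fin.cons_succ]
      have : ∀ ω : Fin n → Ω, p x * ((∏ i, p (ω i)) * (Y x + ∑ i, Y (ω i)) ^ 2) =
          (p x * Y x ^ 2) * (∏ i, p (ω i)) + (2 * p x * Y x) * ((∏ i, p (ω i)) * ∑ i, Y (ω i)) +
          p x * ((∏ i, p (ω i)) * (∑ i, Y (ω i)) ^ 2) := by intro ω; ring
      simp_rw [this, Finset.sum_add_distrib, ← Finset.mul_sum, ih, iid_one p hp n, iid_mean p hp Y n, hY]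
      ring
    simp_rw [e, Finset.sum_add_distrib, ← Finset.sum_mul, hp]
    push_cast; ring

open Classical in
lemma iid_cheb {Ω : Type} [Fintype Ω] (p : Ω → ℝ) (hp0 : ∀ x, 0 ≤ p x) (hp : ∑ x, p x = 1)
    (Y : Ω → ℝ) (hY : ∑ x, p x * Y x = 0) (n : ℕ) (hn : 0 < n) (t : ℝ) (ht : 0 < t) :
    ∑ ω : Fin n → Ω, (∏ i, p (ω i)) * (if n * t < ∑ i, Y (ω i) then 1 else 0) ≤
      (∑ x, p x * Y x ^ 2) / t ^ 2 / n := by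
  have hn' : (0 : ℝ) < n := by exact_mod_cast hn
  have hnt : 0 < n * t := mul_pos hn' ht
  calc _ ≤ ∑ ω : Fin n → Ω, (∏ i, p (ω i)) * (∑ i, Y (ω i)) ^ 2 * ((n * t) ^ 2)⁻¹ := by
        refine Finset.sum_le_sum fun ω _ => ?_
        rw [mul_assoc]
        refine mul_le_mul_of_nonneg_left ?_ (Finset.prod_nonneg fun i _ => hp0 _)
        split_ifs with h
        · rw [← div_eq_mul_inv, one_le_div (by positivity)]
          exact pow_le_pow_left₀ hnt.le h.le 2
        · positivity
    _ = _ := by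
        rw [← Finset.sum_mul, iid_sq p hp Y hY n]
        field_simp

section prob
variable {Ω : Type} [Fintype Ω]

lemma prob_nonneg (μ : FinPMF Ω) {α : Type} [DecidableEq α] (X : Ω → α) (x : α) :
    0 ≤ prob μ X x := Finset.sum_nonneg fun ω _ => μ.nonneg ω

lemma prob_pos (μ : FinPMF Ω) {α : Type} [DecidableEq α] (X : Ω → α) (ω : Ω) (h : 0 < μ.p ω) :
    0 < prob μ X (X ω) :=
  lt_of_lt_of_le h (Finset.single_le_sum (f := μ.p) (fun ω _ => μ.nonneg ω) (by simp))

lemma sum_prob_pair (μ : FinPMF Ω) {α β : Type} [Fintype α] [DecidableEq α] [DecidableEq β]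
    (Y : Ω → α) (Z : Ω → β) (z : β) :
    ∑ y, prob μ (fun ω => (Y ω, Z ω)) (y, z) = prob μ Z z := by
  unfold prob
  rw [← Finset.sum_fiberwise (Finset.univ.filter (fun ω => Z ω = z)) Y]
  refine Finset.sum_congr rfl fun y _ => ?_
  congr 1
  ext ω; simp; tauto

lemma entropy_eq (μ : FinPMF Ω) {α : Type} [Fintype α] [DecidableEq α] (X : Ω → α) :
    entropy μ X = -∑ ω, μ.p ω * Real.logb 2 (prob μ X (X ω)) := by
  unfold entropy
  congr 1
  have := sum_fiber X (fun x => Real.logb 2 (prob μ X x)) μ.p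
  simp_rw [mul_comm (μ.p _)]
  rw [this]
  refine Finset.sum_congr rfl fun x _ => ?_
  rw [mul_comm]; rfl

end prob

section info
set_option linter.unusedSectionVars false
variable {L : ℕ} {S U : Fin L → Type}
    [∀ l, Fintype (S l)] [∀ l, DecidableEq (S l)]
    [∀ l, Fintype (U l)] [∀ l, DecidableEq (U l)]

/-- Conditional law of `U_l` given the prefix. -/
noncomputable def Qk (μ : FinPMF ((∀ l, S l) × (∀ l, U l))) (l : Fin L)
    (z : ∀ j, Option (U j)) (y : U l) : ℝ :=
  if prob μ (fun ω => mask l ω.2) z = 0 then (Fintype.card (U l) : ℝ)⁻¹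
  else prob μ (fun ω => (ω.2 l, mask l ω.2)) (y, z) / prob μ (fun ω => mask l ω.2) z

lemma Qk_nonneg (μ : FinPMF ((∀ l, S l) × (∀ l, U l))) (l : Fin L) (z) (y) : 0 ≤ Qk μ l z y := by
  unfold Qk
  split_ifs
  · positivity
  · exact div_nonneg (prob_nonneg _ _ _) (prob_nonneg _ _ _)

lemma Qk_sum (μ : FinPMF ((∀ l, S l) × (∀ l, U l))) (l : Fin L) [Nonempty (U l)] (z) :
    ∑ y, Qk μ l z y = 1 := by
  unfold Qk
  split_ifs with h
  · simp
  · rw [← Finset.sum_div, sum_prob_pair, div_self h]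

lemma prob_xyz (pS : (∀ l, S l) → ℝ)
    (μ : FinPMF ((∀ l, S l) × (∀ l, U l)))
    (q : (l : Fin L) → S l → (∀ j, Option (U j)) → U l → ℝ)
    (hq1 : ∀ l s v, ∑ u, q l s v u = 1)
    (hfact : ∀ s u, μ.p (s, u) = pS s * ∏ l, q l (s l) (mask l u) (u l))
    [∀ l, Nonempty (U l)] (l : Fin L) (x : S l) (y : U l) (z : ∀ j, Option (U j)) :
    prob μ (fun ω => (ω.1 l, ω.2 l, mask l ω.2)) (x, y, z) =
      q l x z y * prob μ (fun ω => (ω.1 l, mask l ω.2)) (x, z) := by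
  unfold prob
  simp only [Finset.sum_filter, Fintype.sum_prod_type, hfact, Finset.mul_sum, Prod.mk.injEq]
  refine Finset.sum_congr rfl fun s _ => ?_
  by_cases hs : s l = x
  · simp only [hs, true_and]
    have := chain_cond (fun l v y => q l (s l) v y) (fun l v => hq1 l (s l) v) l y z
    rw [hs] at this
    have h2 := congrArg (fun t => pS s * t) this
    simp only [Finset.mul_sum] at h2
    convert h2 using 2 with b b
    · split_ifs <;> simp
    · rw [ite_mul, one_mul, zero_mul]
      split_ifs
      · ring
      · simp
  · simp [hs]

/-- Information density. -/
noncomputable def iota (μ : FinPMF ((∀ l, S l) × (∀ l, U l)))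
    (q : (l : Fin L) → S l → (∀ j, Option (U j)) → U l → ℝ)
    (l : Fin L) (ω : (∀ l, S l) × (∀ l, U l)) : ℝ :=
  Real.logb 2 (q l (ω.1 l) (mask l ω.2) (ω.2 l) / Qk μ l (mask l ω.2) (ω.2 l))

lemma q_pos (pS : (∀ l, S l) → ℝ)
    (μ : FinPMF ((∀ l, S l) × (∀ l, U l)))
    (q : (l : Fin L) → S l → (∀ j, Option (U j)) → U l → ℝ)
    (hq0 : ∀ l s v u, 0 ≤ q l s v u)
    (hfact : ∀ s u, μ.p (s, u) = pS s * ∏ l, q l (s l) (mask l u) (u l))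
    (l : Fin L) (ω : (∀ l, S l) × (∀ l, U l)) (h : 0 < μ.p ω) :
    0 < q l (ω.1 l) (mask l ω.2) (ω.2 l) := by
  refine lt_of_le_of_ne (hq0 _ _ _ _) fun h0 => ?_
  have := hfact ω.1 ω.2
  rw [Finset.prod_eq_zero (Finset.mem_univ l) h0.symm, mul_zero] at this
  exact h.ne' this

lemma Qk_pos (μ : FinPMF ((∀ l, S l) × (∀ l, U l)))
    (l : Fin L) (ω : (∀ l, S l) × (∀ l, U l)) (h : 0 < μ.p ω) :
    0 < Qk μ l (mask l ω.2) (ω.2 l) := by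
  have h1 := prob_pos μ (fun ω => mask l ω.2) ω h
  have h2 := prob_pos μ (fun ω => (ω.2 l, mask l ω.2)) ω h
  unfold Qk
  rw [if_neg h1.ne']
  exact div_pos h2 h1

lemma condMI_eq (pS : (∀ l, S l) → ℝ)
    (μ : FinPMF ((∀ l, S l) × (∀ l, U l)))
    (q : (l : Fin L) → S l → (∀ j, Option (U j)) → U l → ℝ)
    (hq0 : ∀ l s v u, 0 ≤ q l s v u)
    (hq1 : ∀ l s v, ∑ u, q l s v u = 1)
    (hfact : ∀ s u, μ.p (s, u) = pS s * ∏ l, q l (s l) (mask l u) (u l))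
    [∀ l, Nonempty (U l)] (l : Fin L) :
    condMI μ (fun ω => ω.1 l) (fun ω => ω.2 l) (fun ω => mask l ω.2) =
      ∑ ω, μ.p ω * iota μ q l ω := by
  unfold condMI
  simp only [entropy_eq]
  rw [← sub_eq_zero]
  simp only [← Finset.sum_neg_distrib, ← Finset.sum_add_distrib, ← Finset.sum_sub_distrib]
  refine Finset.sum_eq_zero fun ω _ => ?_
  rcases (μ.nonneg ω).eq_or_lt with h | h
  · rw [← h]; simp
  · have h1 := prob_pos μ (fun ω => mask l ω.2) ω h
    have h2 := prob_pos μ (fun ω => (ω.2 l, mask l ω.2)) ω h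
    have h3 := prob_pos μ (fun ω => (ω.1 l, mask l ω.2)) ω h
    have h4 := q_pos pS μ q hq0 hfact l ω h
    have h5 := Qk_pos μ l ω h
    have h6 : Qk μ l (mask l ω.2) (ω.2 l) = prob μ (fun ω => (ω.2 l, mask l ω.2)) (ω.2 l, mask l ω.2) /
      prob μ (fun ω => mask l ω.2) (mask l ω.2) := by unfold Qk; rw [if_neg h1.ne']
    unfold iota
    rw [Real.logb_div h4.ne' h5.ne', h6, Real.logb_div h2.ne' h1.ne', prob_xyz pS μ q hq1 hfact,
      Real.logb_mul h4.ne' h3.ne']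
    ring

lemma info_nonneg (pS : (∀ l, S l) → ℝ)
    (hpS0 : ∀ s, 0 ≤ pS s)
    (hpS1 : ∑ s, pS s = 1)
    (μ : FinPMF ((∀ l, S l) × (∀ l, U l)))
    (q : (l : Fin L) → S l → (∀ j, Option (U j)) → U l → ℝ)
    (hq0 : ∀ l s v u, 0 ≤ q l s v u)
    (hq1 : ∀ l s v, ∑ u, q l s v u = 1)
    (hfact : ∀ s u, μ.p (s, u) = pS s * ∏ l, q l (s l) (mask l u) (u l))
    [∀ l, Nonempty (U l)] (l : Fin L) : 0 ≤ ∑ ω, μ.p ω * iota μ q l ω := by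
  classical
  have hlog2 : 0 < Real.log 2 := Real.log_pos (by norm_num)
  have hterm : ∀ ω : (∀ l, S l) × (∀ l, U l), (μ.p ω - pS ω.1 * ∏ l', Function.update (fun l' v y => q l' (ω.1 l') v y) l
        (fun v y => Qk μ l v y) l' (mask l' ω.2) (ω.2 l')) / Real.log 2 ≤ μ.p ω * iota μ q l ω := by
    intro ω
    have hprod : ∏ l', Function.update (fun l' v y => q l' (ω.1 l') v y) l
        (fun v y => Qk μ l v y) l' (mask l' ω.2) (ω.2 l') =
        (∏ l' ∈ Finset.univ.erase l, q l' (ω.1 l') (mask l' ω.2) (ω.2 l')) *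
          Qk μ l (mask l ω.2) (ω.2 l) := by
      rw [← Finset.prod_erase_mul _ _ (Finset.mem_univ l)]
      simp only [Function.update_self]
      congr 1
      refine Finset.prod_congr rfl fun l' hl' => ?_
      rw [Function.update_of_ne (Finset.ne_of_mem_erase hl')]
    have hrest : 0 ≤ pS ω.1 * ∏ l' ∈ Finset.univ.erase l, q l' (ω.1 l') (mask l' ω.2) (ω.2 l') :=
      mul_nonneg (hpS0 _) (Finset.prod_nonneg fun _ _ => hq0 _ _ _ _)
    have hμ : μ.p ω = (pS ω.1 * ∏ l' ∈ Finset.univ.erase l, q l' (ω.1 l') (mask l' ω.2) (ω.2 l')) *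
        q l (ω.1 l) (mask l ω.2) (ω.2 l) := by
      rw [mul_assoc, Finset.prod_erase_mul _ _ (Finset.mem_univ l)]
      exact hfact ω.1 ω.2
    rw [hprod, ← mul_assoc, div_le_iff₀ hlog2]
    rcases (μ.nonneg ω).eq_or_lt with h | h
    · rw [← h]
      have := mul_nonneg hrest (Qk_nonneg μ l (mask l ω.2) (ω.2 l))
      simp only [zero_mul, zero_sub]
      linarith
    · have h4 := q_pos pS μ q hq0 hfact l ω h
      have h5 := Qk_pos μ l ω h
      unfold iota
      rw [mul_assoc (μ.p ω), Real.logb, div_mul_cancel₀ _ hlog2.ne']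
      rw [hμ]
      set r := pS ω.1 * ∏ l' ∈ Finset.univ.erase l, q l' (ω.1 l') (mask l' ω.2) (ω.2 l')
      set a := q l (ω.1 l) (mask l ω.2) (ω.2 l)
      set b := Qk μ l (mask l ω.2) (ω.2 l)
      have hl := Real.one_sub_inv_le_log_of_pos (div_pos h4 h5)
      have := mul_le_mul_of_nonneg_left hl (mul_nonneg hrest h4.le)
      refine le_trans (le_of_eq ?_) this
      field_simp
  refine le_trans ?_ (Finset.sum_le_sum fun ω _ => hterm ω)
  rw [← Finset.sum_div, Finset.sum_sub_distrib, μ.sum_one, Fintype.sum_prod_type]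
  have : ∀ s : ∀ l, S l, ∑ u : ∀ l, U l, pS s * ∏ l', Function.update (fun l' v y => q l' (s l') v y) l
        (fun v y => Qk μ l v y) l' (mask l' u) (u l') = pS s := by
    intro s
    rw [← Finset.mul_sum, chain_sum_one, mul_one]
    intro l' v
    by_cases h : l' = l
    · subst h; simp only [Function.update_self]; exact Qk_sum μ l' v
    · rw [Function.update_of_ne h]; exact hq1 _ _ _
  simp only [this, hpS1, sub_self, zero_div, le_refl]

end info
end Cascade
namespace Cascade

/-- Letter `i` of a block prefix. -/
def slice {L n : ℕ} {U : Fin L → Type} (v : ∀ j, Option (Fin n → U j)) (i : Fin n) :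
    ∀ j, Option (U j) := fun j => (v j).map (fun x => x i)

lemma slice_mask {L n : ℕ} {U : Fin L → Type} (l : Fin L) (b : ∀ j, Fin n → U j) (i : Fin n) :
    slice (mask l b) i = mask l (fun j => b j i) := by
  funext j
  unfold slice mask
  split_ifs <;> rfl

def blockEquiv {L : ℕ} (n : ℕ) (S U : Fin L → Type) :
    (Fin n → (∀ l, S l) × (∀ l, U l)) ≃ (∀ l, Fin n → S l) × (∀ l, Fin n → U l) where
  toFun ω := (fun l i => (ω i).1 l, fun l i => (ω i).2 l)
  invFun p i := (fun l => p.1 l i, fun l => p.2 l i)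
  left_inv _ := rfl
  right_inv _ := rfl

lemma block_sum {L n : ℕ} {S U : Fin L → Type} [∀ l, Fintype (S l)] [∀ l, Fintype (U l)]
    (H : (∀ l, Fin n → S l) → (∀ l, Fin n → U l) → ℝ) :
    ∑ a, ∑ b, H a b = ∑ ω : Fin n → (∀ l, S l) × (∀ l, U l),
      H (fun l i => (ω i).1 l) (fun l i => (ω i).2 l) := by
  rw [← Fintype.sum_prod_type']
  symm
  exact Fintype.sum_equiv (blockEquiv n S U) _ _ fun ω => rfl

lemma det_code {L n : ℕ} {S U : Fin L → Type} [∀ l, Fintype (S l)] [∀ l, Fintype (U l)]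
    [∀ l, Nonempty (U l)] {Zt Zhat : Type}
    (φ : (∀ l, S l) → Zt) (d : Zt → Zhat → ℝ) (hd : ∀ z zh, 0 ≤ d z zh)
    (pS : (∀ l, S l) → ℝ) (hpS0 : ∀ s, 0 ≤ pS s) (hpS1 : ∑ s, pS s = 1)
    (g : (∀ l, U l) → Zhat) (N : Fin L → ℕ) (hN : ∀ l, 0 < N l)
    (K : ∀ l, (∀ j, Option (Fin n → U j)) → (Fin n → S l) → (Fin n → U l) → ℝ)
    (hK : ∀ l, IsDet (N l) (K l)) :
    ∃ c : Code L n S Zhat, (∀ l, c.M l = Mtot N (l.val + 1)) ∧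
      expect (iidPMF n pS hpS0 hpS1) (avgDistortion φ d c) ≤
        cost (A := fun l => Fin n → S l) (B := fun l => Fin n → U l)
          (fun a => ∏ i, pS (fun l => a l i))
          (fun a b => (n : ℝ)⁻¹ * ∑ i, d (φ (fun l => a l i)) (g (fun l => b l i))) K := by
  classical
  choose e f h1 h0 using hK
  let G : (∀ j, Option (Fin n → U j)) → Fin n → Zhat := fun v i =>
    g (fun l => ((v l).getD (Classical.arbitrary _)) i)
  refine ⟨mkCode N hN e f G, fun l => rfl, ?_⟩
  have hK0 : ∀ l v a b, 0 ≤ K l v a b := by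
    intro l v a b
    by_cases h : f l v (e l v a) = b
    · rw [h1 l v a b h]; norm_num
    · rw [h0 l v a b h]
  unfold expect cost
  let E : (Fin n → ∀ l, S l) ≃ (∀ l, Fin n → S l) := Equiv.piComm (fun _ l => S l)
  rw [← E.sum_comp]
  refine Finset.sum_le_sum fun ω _ => ?_
  let F : ∀ l, (∀ j, Option (Fin n → U j)) → (Fin n → S l) → (Fin n → U l) :=
    fun l v x => f l v (e l v x)
  let b : ∀ l, Fin n → U l := fun j => F j (vv F (E ω) j.val) (E ω j)
  have hb : ∀ l, F l (mask l b) (E ω l) = b l := by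
    intro l
    have := vv_mask F (E ω) l
    change vv F (E ω) l.val = mask l b at this
    rw [← this]
  have hrec : reconstruct (mkCode N hN e f G) ω = fun i => g (fun l => b l i) := by
    unfold reconstruct
    change G (dp N hN f L (msg (mkCode N hN e f G) (E ω) L)) = _
    rw [(mkCode_msg N hN e f G (E ω) L le_rfl).2]
    funext i
    simp only [G]
    congr 1
    funext l
    have := vv_eq F (E ω) L le_rfl l
    rw [if_pos l.isLt] at this
    change ((vv F (E ω) L l).getD _) i = _
    rw [this]
    rfl
  refine le_trans ?_ (Finset.single_le_sum (f := fun b => (∏ i, pS (fun l => E ω l i)) *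
    (∏ l, K l (mask l b) (E ω l) (b l)) *
      ((n : ℝ)⁻¹ * ∑ i, d (φ (fun l => E ω l i)) (g (fun l => b l i)))) ?_ (Finset.mem_univ b))
  · have : ∏ l, K l (mask l b) (E ω l) (b l) = 1 :=
      Finset.prod_eq_one fun l _ => h1 l _ _ _ (hb l)
    simp only [this, mul_one]
    unfold avgDistortion
    rw [hrec]
    exact le_rfl
  · intro b _
    refine mul_nonneg (mul_nonneg (Finset.prod_nonneg fun i _ => hpS0 _)
      (Finset.prod_nonneg fun l _ => hK0 _ _ _ _)) ?_
    exact mul_nonneg (by positivity) (Finset.sum_nonneg fun i _ => hd _ _)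

lemma block_code {L : ℕ} {S U : Fin L → Type}
    [∀ l, Fintype (S l)] [∀ l, DecidableEq (S l)]
    [∀ l, Fintype (U l)] [∀ l, DecidableEq (U l)] [∀ l, Nonempty (U l)]
    {Zt Zhat : Type}
    (φ : (∀ l, S l) → Zt) (d : Zt → Zhat → ℝ) (hd : ∀ z zh, 0 ≤ d z zh)
    (dmax : ℝ) (hdm0 : 0 ≤ dmax) (hdm : ∀ z zh, d z zh ≤ dmax)
    (pS : (∀ l, S l) → ℝ) (hpS0 : ∀ s, 0 ≤ pS s) (hpS1 : ∑ s, pS s = 1)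
    (μ : FinPMF ((∀ l, S l) × (∀ l, U l)))
    (q : (l : Fin L) → S l → (∀ j, Option (U j)) → U l → ℝ)
    (hq0 : ∀ l s v u, 0 ≤ q l s v u)
    (hq1 : ∀ l s v, ∑ u, q l s v u = 1)
    (hfact : ∀ s u, μ.p (s, u) = pS s * ∏ l, q l (s l) (mask l u) (u l))
    (g : (∀ l, U l) → Zhat) (J : Fin L → ℝ) (hJ : ∀ l, J l = ∑ ω, μ.p ω * iota μ q l ω)
    (n : ℕ) (hn : 0 < n) (t : ℝ) (ht : 0 < t) :
    ∃ c : Code L n S Zhat,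
      (∀ l, c.M l = Mtot (fun i => ⌈(n : ℝ) * (2 : ℝ) ^ ((n : ℝ) * (J i + t))⌉₊ + 1) (l.val + 1)) ∧
      expect (iidPMF n pS hpS0 hpS1) (avgDistortion φ d c) ≤
        expect μ (fun ω => d (φ ω.1) (g ω.2)) +
        dmax * (1 - (1 - Real.exp (-n)) ^ L *
          (1 - (∑ l, (∑ ω, μ.p ω * (iota μ q l ω - J l) ^ 2) / t ^ 2) / n)) := by
  classical
  have hn' : (0 : ℝ) < n := by exact_mod_cast hn
  have hJ0 : ∀ l, 0 ≤ J l := fun l => by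
    rw [hJ]; exact info_nonneg pS hpS0 hpS1 μ q hq0 hq1 hfact l
  set T : Fin L → ℝ := fun i => (2 : ℝ) ^ ((n : ℝ) * (J i + t)) with hTdef
  have hT1 : ∀ l, 1 ≤ T l := fun l =>
    Real.one_le_rpow (by norm_num) (mul_nonneg hn'.le (by linarith [hJ0 l]))
  have hT0 : ∀ l, 0 < T l := fun l => by linarith [hT1 l]
  let K : ∀ l, (∀ j, Option (Fin n → U j)) → (Fin n → S l) → (Fin n → U l) → ℝ :=
    fun l v a b => ∏ i, q l (a i) (slice v i) (b i)
  let Q : ∀ l, (∀ j, Option (Fin n → U j)) → (Fin n → U l) → ℝ :=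
    fun l v b => ∏ i, Qk μ l (slice v i) (b i)
  let pA : (∀ l, Fin n → S l) → ℝ := fun a => ∏ i, pS (fun l => a l i)
  let δ : (∀ l, Fin n → S l) → (∀ l, Fin n → U l) → ℝ := fun a b =>
    (n : ℝ)⁻¹ * ∑ i, d (φ (fun l => a l i)) (g (fun l => b l i))
  have hpA0 : ∀ a, 0 ≤ pA a := fun a => Finset.prod_nonneg fun i _ => hpS0 _
  have hpA1 : ∑ a, pA a = 1 := by
    let E : (Fin n → ∀ l, S l) ≃ (∀ l, Fin n → S l) := Equiv.piComm (fun _ l => S l)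
    rw [← E.sum_comp]
    exact iid_one pS hpS1 n
  have hδ0 : ∀ a b, 0 ≤ δ a b := fun a b =>
    mul_nonneg (by positivity) (Finset.sum_nonneg fun i _ => hd _ _)
  have hδ1 : ∀ a b, δ a b ≤ dmax := by
    intro a b
    have : ∑ i : Fin n, d (φ (fun l => a l i)) (g (fun l => b l i)) ≤ ∑ _i : Fin n, dmax :=
      Finset.sum_le_sum fun i _ => hdm _ _
    rw [Finset.sum_const, Finset.card_univ, Fintype.card_fin, nsmul_eq_mul] at this
    simp only [δ]
    rw [inv_mul_le_iff₀ hn']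
    exact this
  have hK0 : ∀ l v a b, 0 ≤ K l v a b := fun l v a b => Finset.prod_nonneg fun i _ => hq0 _ _ _ _
  have hK1 : ∀ l v a, ∑ b, K l v a b = 1 := by
    intro l v a
    simp only [K]
    rw [← Fintype.piFinset_univ, ← Finset.prod_univ_sum (fun _ => Finset.univ)
      (fun i u => q l (a i) (slice v i) u)]
    exact Finset.prod_eq_one fun i _ => hq1 _ _ _
  have hQ0 : ∀ l v b, 0 ≤ Q l v b := fun l v b => Finset.prod_nonneg fun i _ => Qk_nonneg μ l _ _
  have hQ1 : ∀ l v, ∑ b, Q l v b = 1 := by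
    intro l v
    simp only [Q]
    rw [← Fintype.piFinset_univ, ← Finset.prod_univ_sum (fun _ => Finset.univ)
      (fun i u => Qk μ l (slice v i) u)]
    exact Finset.prod_eq_one fun i _ => Qk_sum μ l _
  have hη0 : 0 ≤ Real.exp (-(n : ℝ)) := (Real.exp_pos _).le
  have hη1 : Real.exp (-(n : ℝ)) ≤ 1 := Real.exp_le_one_iff.2 (by linarith)
  obtain ⟨K', hdet, hcost⟩ := one_shot (A := fun l => Fin n → S l) (B := fun l => Fin n → U l)
    pA hpA0 hpA1 δ hδ0 dmax hδ1 K hK0 hK1 Q hQ0 hQ1 T hT1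
    (fun l => ⌈(n : ℝ) * T l⌉₊) (Real.exp (-n)) hη0 hη1 (by
      intro l
      rw [Real.exp_le_exp, neg_le_neg_iff, le_div_iff₀ (hT0 l)]
      exact Nat.le_ceil _)
  obtain ⟨c, hc1, hc2⟩ := det_code φ d hd pS hpS0 hpS1 g _ (fun l => Nat.succ_pos _) K' hdet
  refine ⟨c, hc1, hc2.trans (hcost.trans ?_)⟩
  -- the block law
  have hlaw : ∀ ω : Fin n → (∀ l, S l) × (∀ l, U l),
      pA (fun l i => (ω i).1 l) * (∏ l, K l (mask l (fun l i => (ω i).2 l)) (fun i => (ω i).1 l)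
        (fun i => (ω i).2 l)) = ∏ i, μ.p (ω i) := by
    intro ω
    simp only [pA, K, slice_mask]
    rw [Finset.prod_comm, ← Finset.prod_mul_distrib]
    exact Finset.prod_congr rfl fun i _ => (hfact _ _).symm
  have hc : cost pA δ K = expect μ (fun ω => d (φ ω.1) (g ω.2)) := by
    unfold cost
    rw [block_sum]
    simp only [hlaw, δ]
    have := iid_mean μ.p μ.sum_one (fun ω => d (φ ω.1) (g ω.2)) n
    unfold expect
    have e : ∀ ω : Fin n → (∀ l, S l) × (∀ l, U l),
      (∏ i, μ.p (ω i)) * ((n : ℝ)⁻¹ * ∑ i, d (φ (ω i).1) (g (ω i).2)) =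
      (n : ℝ)⁻¹ * ((∏ i, μ.p (ω i)) * ∑ i, d (φ (ω i).1) (g (ω i).2)) := fun ω => by ring
    simp only [e]
    rw [← Finset.mul_sum, this, ← mul_assoc, inv_mul_cancel₀ hn'.ne', one_mul]
  rw [hc]
  refine add_le_add_right (mul_le_mul_of_nonneg_left ?_ hdm0) _
  refine sub_le_sub_left (mul_le_mul_of_nonneg_left ?_ (pow_nonneg (by linarith) _)) _
  rw [block_sum]
  simp only [hlaw]
  have hcheb : ∀ l, ∑ ω : Fin n → (∀ l, S l) × (∀ l, U l), (∏ i, μ.p (ω i)) *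
      (if (n : ℝ) * t < ∑ i, (iota μ q l (ω i) - J l) then 1 else 0) ≤
      (∑ ω, μ.p ω * (iota μ q l ω - J l) ^ 2) / t ^ 2 / n := by
    intro l
    refine iid_cheb μ.p μ.nonneg μ.sum_one (fun ω => iota μ q l ω - J l) ?_ n hn t ht
    simp only [mul_sub, Finset.sum_sub_distrib]
    rw [← Finset.sum_mul, μ.sum_one, hJ l]; ring
  rw [Finset.sum_div]
  refine le_trans (sub_le_sub_left (Finset.sum_le_sum fun l _ => hcheb l) 1) ?_
  rw [Finset.sum_comm]
  refine le_trans (le_of_eq (congrArg (fun x => x - _) (iid_one μ.p μ.sum_one n).symm)) ?_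
  beta_reduce
  rw [← Finset.sum_sub_distrib]
  refine Finset.sum_le_sum fun ω _ => ?_
  rw [← Finset.mul_sum]
  have hP0 : 0 ≤ ∏ i, μ.p (ω i) := Finset.prod_nonneg fun i _ => μ.nonneg _
  rcases hP0.eq_or_lt with hz | hpos
  · rw [← hz]; simp
  have hμpos : ∀ i, 0 < μ.p (ω i) := by
    intro i
    refine lt_of_le_of_ne (μ.nonneg _) fun h => ?_
    rw [Finset.prod_eq_zero (Finset.mem_univ i) h.symm] at hpos
    exact lt_irrefl _ hpos
  have hnn : ∀ l, (0 : ℝ) ≤ (if (n : ℝ) * t < ∑ i, (iota μ q l (ω i) - J l) then 1 else 0) := by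
    intro l; split_ifs <;> norm_num
  suffices hs : 1 - ∑ l, (if (n : ℝ) * t < ∑ i, (iota μ q l (ω i) - J l) then (1 : ℝ) else 0) ≤
      (if ∀ l, K l (mask l (fun l i => (ω i).2 l)) (fun i => (ω i).1 l) (fun i => (ω i).2 l) ≤
        T l * Q l (mask l (fun l i => (ω i).2 l)) (fun i => (ω i).2 l) then (1 : ℝ) else 0) by
    have := mul_le_mul_of_nonneg_left hs hP0
    rw [mul_sub, mul_one] at this
    exact this
  split_ifs with hgood
  · linarith [Finset.sum_nonneg fun l (_ : l ∈ Finset.univ) => hnn l]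
  · push Not at hgood
    obtain ⟨l, hl⟩ := hgood
    have hbad : (n : ℝ) * t < ∑ i, (iota μ q l (ω i) - J l) := by
      simp only [K, Q, slice_mask] at hl
      have hq : ∏ i, q l ((ω i).1 l) (mask l (ω i).2) ((ω i).2 l) =
          (2 : ℝ) ^ (∑ i, iota μ q l (ω i)) * ∏ i, Qk μ l (mask l (ω i).2) ((ω i).2 l) := by
        rw [Real.rpow_sum_of_pos (by norm_num), ← Finset.prod_mul_distrib]
        refine Finset.prod_congr rfl fun i _ => ?_
        have h4 := q_pos pS μ q hq0 hfact l (ω i) (hμpos i)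
        have h5 := Qk_pos μ l (ω i) (hμpos i)
        unfold iota
        rw [Real.rpow_logb (by norm_num) (by norm_num) (div_pos h4 h5), div_mul_cancel₀ _ h5.ne']
      have hQpos : 0 < ∏ i, Qk μ l (mask l (ω i).2) ((ω i).2 l) :=
        Finset.prod_pos fun i _ => Qk_pos μ l (ω i) (hμpos i)
      have hl2 : T l * ∏ i, Qk μ l (mask l (ω i).2) ((ω i).2 l) <
          ∏ i, q l ((ω i).1 l) (mask l (ω i).2) ((ω i).2 l) := hl
      rw [hq] at hl2
      have hl3 := lt_of_mul_lt_mul_right hl2 hQpos.le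
      simp only [hTdef] at hl3
      rw [Real.rpow_lt_rpow_left_iff (by norm_num)] at hl3
      rw [Finset.sum_sub_distrib, Finset.sum_const, Finset.card_univ, Fintype.card_fin, nsmul_eq_mul]
      linarith
    have := Finset.single_le_sum (fun l (_ : l ∈ Finset.univ) => hnn l) (Finset.mem_univ l)
    rw [if_pos hbad] at this
    linarith

lemma choose_n (L : ℕ) (dmax C ε' ε : ℝ) (hε' : 0 < ε') (hε : 0 < ε) :
    ∃ n : ℕ, 0 < n ∧ Real.logb 2 (3 * n) / n ≤ ε' ∧
      dmax * (1 - (1 - Real.exp (-n)) ^ L * (1 - C / n)) ≤ ε := by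
  have h1 : Filter.Tendsto (fun n : ℕ => Real.logb 2 (3 * n) / n) Filter.atTop (nhds 0) := by
    have hA : Filter.Tendsto (fun n : ℕ => Real.log n / n) Filter.atTop (nhds 0) :=
      (Real.isLittleO_log_id_atTop.tendsto_div_nhds_zero).comp tendsto_natCast_atTop_atTop
    have hB : Filter.Tendsto (fun n : ℕ => Real.log 3 / (n : ℝ)) Filter.atTop (nhds 0) :=
      tendsto_const_div_atTop_nhds_zero_nat _
    have hC := (hB.add hA).div_const (Real.log 2)
    simp only [add_zero, zero_div] at hC
    refine hC.congr' ?_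
    filter_upwards [Filter.eventually_gt_atTop 0] with n hn
    have : (n : ℝ) ≠ 0 := by exact_mod_cast hn.ne'
    rw [Real.logb, Real.log_mul (by norm_num) this]
    ring
  have h2 : Filter.Tendsto (fun n : ℕ => dmax * (1 - (1 - Real.exp (-n)) ^ L * (1 - C / n)))
      Filter.atTop (nhds (dmax * (1 - (1 - 0) ^ L * (1 - 0)))) := by
    have hE : Filter.Tendsto (fun n : ℕ => Real.exp (-(n : ℝ))) Filter.atTop (nhds 0) :=
      Real.tendsto_exp_neg_atTop_nhds_zero.comp tendsto_natCast_atTop_atTop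
    have hB : Filter.Tendsto (fun n : ℕ => C / (n : ℝ)) Filter.atTop (nhds 0) :=
      tendsto_const_div_atTop_nhds_zero_nat _
    exact ((((hE.const_sub 1).pow L).mul (hB.const_sub 1)).const_sub 1).const_mul dmax
  simp only [sub_zero, one_pow, mul_one, sub_self, mul_zero] at h2
  obtain ⟨n, hn⟩ := ((Filter.eventually_gt_atTop 0).and
    ((h1.eventually_le_const hε').and (h2.eventually_le_const hε))).exists
  exact ⟨n, hn.1, hn.2.1, hn.2.2⟩


/-- **Theorem 1 (achievability of the Improved Routing scheme).**
Given auxiliaries `(U_1,…,U_L)` jointly distributed with the sources according to a pmf of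
the form `p(s_1,…,s_L) ∏_l p(u_l | s_l, u_1,…,u_{l-1})` (the conditional pmf of `U_l` is a
kernel `q l` depending on `s_l` and on the prefix `u_1,…,u_{l-1}`, encoded as the masked
tuple `fun j => if j < l then some (u j) else none`), and a reconstruction function `g` with
`E[d(φ(S), g(U))] ≤ D`, any rate tuple with
`R_l ≥ Σ_{i ≤ l} I(S_i; U_i | U_1,…,U_{i-1})` achieves distortion `D`. -/
theorem improved_routing_achievability
    {L : ℕ} {S U : Fin L → Type}
    [∀ l, Fintype (S l)] [∀ l, DecidableEq (S l)]
    [∀ l, Fintype (U l)] [∀ l, DecidableEq (U l)]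
    {Zt Zhat : Type} [Fintype Zt] [Fintype Zhat]
    (φ : (∀ l, S l) → Zt) (d : Zt → Zhat → ℝ) (hd : ∀ z zh, 0 ≤ d z zh)
    (pS : (∀ l, S l) → ℝ) (hpS0 : ∀ s, 0 ≤ pS s) (hpS1 : ∑ s, pS s = 1)
    (μ : FinPMF ((∀ l, S l) × (∀ l, U l)))
    (q : (l : Fin L) → S l → (∀ j, Option (U j)) → U l → ℝ)
    (hq0 : ∀ l s v u, 0 ≤ q l s v u)
    (hq1 : ∀ l s v, ∑ u, q l s v u = 1)
    (hfact : ∀ s u, μ.p (s, u) =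
      pS s * ∏ l, q l (s l) (fun j => if j < l then some (u j) else none) (u l))
    (g : (∀ l, U l) → Zhat)
    (D : ℝ) (hdist : expect μ (fun ω => d (φ ω.1) (g ω.2)) ≤ D)
    (R : Fin L → ℝ)
    (hR : ∀ l : Fin L,
      (∑ i ∈ Finset.univ.filter (fun i : Fin L => i ≤ l),
        condMI μ (fun ω => ω.1 i) (fun ω => ω.2 i)
          (fun ω => fun j => if j < i then some (ω.2 j) else none)) ≤ R l) :
    AchievesDistortion pS hpS0 hpS1 φ d R D := by
  have hU : ∀ l, Nonempty (U l) := by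
    intro l
    have hS : Nonempty (∀ l, S l) := by
      by_contra h
      rw [not_nonempty_iff] at h
      simp at hpS1
    obtain ⟨s⟩ := hS
    by_contra h
    rw [not_nonempty_iff] at h
    have := hq1 l (s l) (fun _ => none)
    simp at this
  intro ε hε
  set J : Fin L → ℝ := fun l => ∑ ω, μ.p ω * iota μ q l ω with hJ
  have hJR : ∀ l : Fin L, ∑ i ∈ Finset.univ.filter (fun i : Fin L => i ≤ l), J i ≤ R l := by
    intro l
    refine le_trans (le_of_eq (Finset.sum_congr rfl fun i _ => ?_)) (hR l)
    exact (condMI_eq pS μ q hq0 hq1 hfact i).symm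
  set dmax : ℝ := ∑ z, ∑ zh, d z zh with hdmax
  have hdm0 : 0 ≤ dmax := Finset.sum_nonneg fun z _ => Finset.sum_nonneg fun zh _ => hd z zh
  have hdm : ∀ z zh, d z zh ≤ dmax := fun z zh =>
    le_trans (Finset.single_le_sum (f := fun zh => d z zh) (fun zh _ => hd z zh) (Finset.mem_univ zh))
      (Finset.single_le_sum (f := fun z => ∑ zh, d z zh)
        (fun z _ => Finset.sum_nonneg fun zh _ => hd z zh) (Finset.mem_univ z))
  set t : ℝ := ε / (2 * (L + 1)) with ht
  have hL0 : (0 : ℝ) ≤ L := Nat.cast_nonneg L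
  have ht0 : 0 < t := by positivity
  obtain ⟨n, hn, hn1, hn2⟩ := choose_n L dmax
    (∑ l, (∑ ω, μ.p ω * (iota μ q l ω - J l) ^ 2) / t ^ 2) t ε ht0 hε
  obtain ⟨c, hc1, hc2⟩ := block_code φ d hd dmax hdm0 hdm pS hpS0 hpS1 μ q hq0 hq1 hfact g J
    (fun _ => rfl) n hn t ht0
  refine ⟨n, hn, c, ?_, by linarith⟩
  intro l
  have hn' : (1 : ℝ) ≤ n := by exact_mod_cast hn
  have hJ0 : ∀ l, 0 ≤ J l := fun l => info_nonneg pS hpS0 hpS1 μ q hq0 hq1 hfact l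
  rw [hc1 l]
  have hone : ∀ i : Fin L, Real.logb 2
      ((⌈(n : ℝ) * (2 : ℝ) ^ ((n : ℝ) * (J i + t))⌉₊ + 1 : ℕ) : ℝ) / n ≤ J i + 2 * t := by
    intro i
    set X : ℝ := (2 : ℝ) ^ ((n : ℝ) * (J i + t)) with hX
    have hX1 : 1 ≤ X := Real.one_le_rpow (by norm_num) (mul_nonneg (by linarith) (by linarith [hJ0 i]))
    have hnX : 1 ≤ n * X := by nlinarith
    have hle : ((⌈(n : ℝ) * X⌉₊ + 1 : ℕ) : ℝ) ≤ (3 * n) * X := by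
      push_cast
      have := (Nat.ceil_lt_add_one (by linarith : 0 ≤ (n : ℝ) * X)).le
      linarith
    have h1 : Real.logb 2 ((⌈(n : ℝ) * X⌉₊ + 1 : ℕ) : ℝ) ≤ Real.logb 2 (3 * n) + n * (J i + t) := by
      refine le_trans (Real.logb_le_logb_of_le (by norm_num) (by positivity) hle) (le_of_eq ?_)
      rw [Real.logb_mul (by positivity) (by positivity), hX, Real.logb_rpow (by norm_num) (by norm_num)]
    have h2 := div_le_div_of_nonneg_right h1 (by linarith : (0 : ℝ) ≤ n)
    rw [add_div, mul_div_cancel_left₀ _ (by linarith : (n : ℝ) ≠ 0)] at h2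
    linarith
  have hfil : Finset.univ.filter (fun i : Fin L => i.val < l.val + 1) =
      Finset.univ.filter (fun i : Fin L => i ≤ l) := by
    refine Finset.filter_congr fun i _ => ?_
    rw [Fin.le_def, Nat.lt_succ_iff]
  unfold Mtot
  rw [hfil, Nat.cast_prod, Real.logb_prod _ _ (fun i _ => by positivity), Finset.sum_div]
  refine le_trans (Finset.sum_le_sum fun i _ => hone i) ?_
  rw [Finset.sum_add_distrib, Finset.sum_const, nsmul_eq_mul]
  have hcard : ((Finset.univ.filter (fun i : Fin L => i ≤ l)).card : ℝ) ≤ (L : ℝ) := by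
    have := Finset.card_filter_le (Finset.univ : Finset (Fin L)) (fun i => i ≤ l)
    rw [Finset.card_univ, Fintype.card_fin] at this
    exact_mod_cast this
  have h3 := mul_le_mul_of_nonneg_right hcard (by linarith : 0 ≤ 2 * t)
  have h4 : (L : ℝ) * (2 * t) ≤ ε := by
    rw [ht]
    have e : (L : ℝ) * (2 * (ε / (2 * (L + 1)))) = ε * (L / (L + 1)) := by field_simp
    rw [e]
    refine mul_le_of_le_one_right hε.le ?_
    rw [div_le_one (by linarith)]; linarith
  linarith [hJR l]

end Cascade
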